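/- Let σ = (σ_G, σ_⋈) be a twist of a self-similar action (G,E). Then σ_⋈ extends to a map σ_⋈ : G*E^* → 𝕋 determined inductively by σ_⋈(h, eμ) = σ_⋈(h,e)·σ_⋈(h|_e, μ) for composable (h,e,μ) ∈ G*E¹*E^* and σ_⋈(h, s(h)) = 1, and this extension satisfies, for all (g,h,λ,μ) ∈ G²*E^**E^*: (1) σ_⋈(h,s(h)) = 1 and σ_⋈(r(μ),μ) = 1; (2) σ_⋈(h,λμ) = σ_⋈(h,λ)·σ_⋈(h|_λ, μ); (3) σ_⋈(h,λ)·conj(σ_⋈(gh,λ))·σ_⋈(g, h·λ) = conj(σ_G(g|_{h·λ}, h|_λ))·σ_G(g,h). -/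

import Mathlib

noncomputable section

attribute [local instance] Classical.propDecidable

/-- Raw algebraic data of an inverse semigroup with zero, together with a domain
predicate singling out its genuine elements (the carrier may contain junk). -/
structure RawSem (T : Type) where
  mul : T → T → T
  star : T → T
  zero : T
  dom : T → Prop

namespace RawSem

variable {T : Type} (R : RawSem T)

/-- The natural partial order: `t ≤ u` iff `t = u ⬝ t* ⬝ t`. -/
def le (t u : T) : Prop := t = R.mul u (R.mul (R.star t) t)

/-- Nonzero idempotents (belonging to the domain). -/
def NzIdem (e : T) : Prop := R.dom e ∧ R.mul e e = e ∧ e ≠ R.zero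

/-- `F` covers the idempotent `e`: every nonzero idempotent below `e` meets some `f ∈ F`. -/
def Covers (F : Set T) (e : T) : Prop :=
  ∀ z, R.NzIdem z → R.le z e → ∃ f ∈ F, R.mul z f ≠ R.zero

/-- The set `F_t` of nonzero idempotents trivially fixed by `t`, i.e. `≤ t`. -/
def TrivFix (t : T) : Set T := {e | R.NzIdem e ∧ R.le e t}

/-- The idempotent `e` is fixed by `t`:
`(t ⬝ f ⬝ t*) ⬝ f ≠ 0` for every nonzero idempotent `f ≤ e`. -/
def FixedBy (e t : T) : Prop :=
  ∀ f, R.NzIdem f → R.le f e → R.mul (R.mul (R.mul t f) (R.star t)) f ≠ R.zero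

/-- The inverse semigroup is closed. -/
def Closed : Prop :=
  ∀ t, R.dom t → ∃ F : Finset T, ↑F ⊆ R.TrivFix t ∧ ∀ e ∈ R.TrivFix t, R.Covers ↑F e

/-- The inverse semigroup is topologically free. -/
def TopFree : Prop :=
  ∀ t e, R.dom t → R.NzIdem e → R.FixedBy e t → ∃ f ∈ R.TrivFix t, R.mul f e ≠ R.zero

/-- The inverse semigroup is effective. -/
def Effective : Prop :=
  ∀ t e, R.dom t → R.NzIdem e → R.FixedBy e t →
    ∃ F : Finset T, ↑F ⊆ R.TrivFix t ∧ R.Covers (↑F) e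

/-- The inverse semigroup is minimal. -/
def Minimal : Prop :=
  ∀ e f, R.NzIdem e → R.NzIdem f → ∃ Ts : Finset T, (∀ t ∈ Ts, R.dom t) ∧
    R.Covers ((fun t => R.mul (R.mul t f) (R.star t)) '' ↑Ts) e

/-- The inverse semigroup is quasi-fundamental. -/
def QuasiFund : Prop :=
  ∀ s t, R.dom s → R.dom t → s ≠ R.zero → t ≠ R.zero →
    (∀ e, R.NzIdem e → R.mul (R.mul s e) (R.star s) = R.mul (R.mul t e) (R.star t)) →
    ∃ u, R.dom u ∧ u ≠ R.zero ∧ R.le u s ∧ R.le u t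

/-- The inverse semigroup is fundamental. -/
def Fund : Prop :=
  ∀ s t, R.dom s → R.dom t →
    (∀ e, R.NzIdem e → R.mul (R.mul s e) (R.star s) = R.mul (R.mul t e) (R.star t)) → s = t

/-- The inverse semigroup is `E*`-unitary. -/
def EUnitary : Prop := ∀ t e, R.dom t → R.NzIdem e → R.le e t → R.mul t t = t

/-- The inverse semigroup is locally contracting. -/
def LocContr : Prop :=
  ∀ e, R.NzIdem e → ∃ s, R.dom s ∧ ∃ F : Finset T, ∃ f₀ ∈ F,
    (∀ f ∈ F, R.NzIdem f ∧ R.le f (R.mul e (R.mul (R.star s) s))) ∧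
    ∀ f ∈ F, R.Covers (↑F) (R.mul (R.mul s f) (R.star s)) ∧
      R.mul f₀ (R.mul (R.mul s f) (R.star s)) = R.zero

/-- The inverse semigroup is strongly locally contracting. -/
def StrLocContr : Prop :=
  ∀ e, R.NzIdem e → ∃ s f₀ f₁, R.dom s ∧ R.NzIdem f₀ ∧ R.NzIdem f₁ ∧
    R.le f₀ f₁ ∧ R.le f₁ (R.mul e (R.mul (R.star s) s)) ∧
    R.le (R.mul (R.mul s f₁) (R.star s)) f₁ ∧
    R.mul f₀ (R.mul (R.mul s f₁) (R.star s)) = R.zero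

end RawSem

/-- A self-similar action `(G, E)` of a discrete groupoid `G` on a directed graph `E`
sharing the vertex/unit set `V`, encoded by total operations together with axioms
that hold on composable inputs.  Arrows `g` have source `gs g` and range `gr g`;
edges `e` have source `es e` and range `er e`; `g · e` (written `act g e`) and
`g |_e` (written `res g e`) are meaningful when `gs g = er e`. -/
structure SSA where
  V : Type
  G : Type
  E : Type
  gs : G → V
  gr : G → V
  es : E → V
  er : E → V
  one : V → G
  mul : G → G → G
  inv : G → G
  act : G → E → E
  res : G → E → G
  gs_one : ∀ v, gs (one v) = v
  gr_one : ∀ v, gr (one v) = v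
  gs_mul : ∀ g h, gs g = gr h → gs (mul g h) = gs h
  gr_mul : ∀ g h, gs g = gr h → gr (mul g h) = gr g
  mul_assoc' : ∀ g h k, gs g = gr h → gs h = gr k → mul (mul g h) k = mul g (mul h k)
  one_mul' : ∀ g, mul (one (gr g)) g = g
  mul_one' : ∀ g, mul g (one (gs g)) = g
  gs_inv : ∀ g, gs (inv g) = gr g
  gr_inv : ∀ g, gr (inv g) = gs g
  mul_inv' : ∀ g, mul g (inv g) = one (gr g)
  inv_mul' : ∀ g, mul (inv g) g = one (gs g)
  er_act : ∀ g e, gs g = er e → er (act g e) = gr g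
  act_one : ∀ e, act (one (er e)) e = e
  act_mul : ∀ g h e, gs g = gr h → gs h = er e → act (mul g h) e = act g (act h e)
  gs_res : ∀ g e, gs g = er e → gs (res g e) = es e
  gr_res : ∀ g e, gs g = er e → gr (res g e) = es (act g e)
  res_mul : ∀ g h e, gs g = gr h → gs h = er e →
    res (mul g h) e = mul (res g (act h e)) (res h e)

namespace SSA

/-- Finite paths in the graph: `Pth S a b` is the type of paths with range `a`
and source `b`; `cons e p` is the path `e · p`. -/
inductive Pth (S : SSA) : S.V → S.V → Type
  | nil (v : S.V) : Pth S v v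
  | cons (e : S.E) {b : S.V} (p : Pth S (S.es e) b) : Pth S (S.er e) b

/-- The path category `E^*`, bundled: a finite path with its range and source. -/
structure Path (S : SSA) where
  rng : S.V
  src : S.V
  pth : S.Pth rng src

/-- Infinite paths: sequences of edges `e₁e₂⋯` with `es eᵢ = er e_{i+1}`. -/
structure InfPath (S : SSA) where
  seq : ℕ → S.E
  chain : ∀ n, S.es (seq n) = S.er (seq (n + 1))

/-- A twist `σ = (σ_G, σ_⋈)` of the self-similar action, with values in the
unit circle `𝕋 ⊆ ℂ`. -/
structure Twist (S : SSA) where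
  σG : S.G → S.G → ℂ
  σB : S.G → S.E → ℂ
  σG_unimod : ∀ g h, S.gs g = S.gr h → ‖σG g h‖ = 1
  σB_unimod : ∀ g e, S.gs g = S.er e → ‖σB g e‖ = 1
  σG_cocycle : ∀ g h k, S.gs g = S.gr h → S.gs h = S.gr k →
    σG g h * σG (S.mul g h) k = σG h k * σG g (S.mul h k)
  σG_one_left : ∀ g, σG (S.one (S.gr g)) g = 1
  σG_one_right : ∀ g, σG g (S.one (S.gs g)) = 1
  σB_one : ∀ e, σB (S.one (S.er e)) e = 1
  σB_cocycle : ∀ g h e, S.gs g = S.gr h → S.gs h = S.er e →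
    σB h e * (starRingEnd ℂ) (σB (S.mul g h) e) * σB g (S.act h e) =
      (starRingEnd ℂ) (σG (S.res g (S.act h e)) (S.res h e)) * σG g h

variable {S : SSA}

namespace Pth

def length : ∀ {a b : S.V}, S.Pth a b → ℕ
  | _, _, .nil _ => 0
  | _, _, .cons _ p => length p + 1

def toList : ∀ {a b : S.V}, S.Pth a b → List S.E
  | _, _, .nil _ => []
  | _, _, .cons e p => e :: toList p

def comp : ∀ {a b c : S.V}, S.Pth a b → S.Pth b c → S.Pth a c
  | _, _, _, .nil _, q => q
  | _, _, _, .cons e p, q => .cons e (comp p q)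

end Pth

def Path.length (p : Path S) : ℕ := p.pth.length

def Path.toList (p : Path S) : List S.E := p.pth.toList

/-- A vertex regarded as a path of length `0`. -/
def Path.vert (S : SSA) (v : S.V) : Path S := ⟨v, v, .nil v⟩

/-- An edge regarded as a path of length `1`. -/
def Path.ofEdge (S : SSA) (e : S.E) : Path S := ⟨S.er e, S.es e, .cons e (.nil (S.es e))⟩

/-- Concatenation of paths (junk -- the first path -- when not composable). -/
def Path.comp (p q : Path S) : Path S :=
  if h : p.src = q.rng then
    ⟨p.rng, q.src, Pth.comp (cast (congrArg (S.Pth p.rng) h) p.pth) q.pth⟩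
  else p

/-- `q` is a prefix of `p`, i.e. `p` extends `q`. -/
def IsPrefix (S : SSA) (q p : Path S) : Prop :=
  ∃ r : Path S, q.src = r.rng ∧ p = q.comp r

/-- Two paths are comparable if one is a prefix of the other. -/
def Comparable (S : SSA) (p q : Path S) : Prop := IsPrefix S p q ∨ IsPrefix S q p

/-- The extended left action of groupoid arrows on finite paths,
given by the recursive recipe `g · v = r g`, `g · (e μ) = (g · e) (g|_e · μ)`. -/
def pactAux (S : SSA) : ∀ {a b : S.V}, S.G → S.Pth a b → Path S
  | _, _, g, .nil _ => Path.vert S (S.gr g)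
  | _, _, g, .cons e p => (Path.ofEdge S (S.act g e)).comp (pactAux S (S.res g e) p)

/-- The extended left action `g · μ` on finite paths. -/
def pact (S : SSA) (g : S.G) (p : Path S) : Path S := pactAux S g p.pth

/-- The extended restriction map, given by `g|_v = g` and `g|_{e μ} = (g|_e)|_μ`. -/
def presAux (S : SSA) : ∀ {a b : S.V}, S.G → S.Pth a b → S.G
  | _, _, g, .nil _ => g
  | _, _, g, .cons e p => presAux S (S.res g e) p

/-- The extended restriction map `g |_μ` on finite paths. -/
def pres (S : SSA) (g : S.G) (p : Path S) : S.G := presAux S g p.pth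

/-- `g` strongly fixes the path `p` : `g · p = p` and `g|_p = s p`. -/
def SFix (S : SSA) (g : S.G) (p : Path S) : Prop :=
  S.gs g = p.rng ∧ pact S g p = p ∧ pres S g p = S.one p.src

/-- `p` is a minimal strongly `g`-fixed path. -/
def MinSFix (S : SSA) (g : S.G) (p : Path S) : Prop :=
  SFix S g p ∧ ∀ q : Path S, IsPrefix S q p → q ≠ p → ¬ SFix S g q

/-- `g` is a unit of the groupoid (an element of `G⁰`). -/
def IsUnitArrow (S : SSA) (g : S.G) : Prop := g = S.one (S.gs g)

/-- `g` fixes every path in `s(g)E^*`. -/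
def FixesAll (S : SSA) (g : S.G) : Prop :=
  ∀ p : Path S, p.rng = S.gs g → pact S g p = p

/-- Condition (Fin): every `g` admits at most finitely many minimal strongly
`g`-fixed paths. -/
def CondFin (S : SSA) : Prop := ∀ g : S.G, {p : Path S | MinSFix S g p}.Finite

/-- Condition (Evr): if `g` fixes every path in `s(g)E^*` then `g` strongly fixes
some path in `s(g)E^*`. -/
def CondEvr (S : SSA) : Prop := ∀ g : S.G, FixesAll S g → ∃ p : Path S, SFix S g p

/-- `p` is a `g`-cycle: a path of positive length with `g · s(p) = r(p)`. -/
def GCycle (S : SSA) (g : S.G) (p : Path S) : Prop :=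
  1 ≤ p.length ∧ S.gs g = p.src ∧ S.gr g = p.rng

/-- The vertex `v` receives at least two distinct edges. -/
def HasEntranceVert (S : SSA) (v : S.V) : Prop :=
  ∃ e f : S.E, e ≠ f ∧ S.er e = v ∧ S.er f = v

/-- Base vertices of a finite path. -/
def Path.baseVerts (p : Path S) : Set S.V :=
  insert p.rng {v : S.V | ∃ e ∈ p.toList, S.es e = v}

/-- A finite path has an entrance. -/
def Path.hasEntrance (p : Path S) : Prop := ∃ v ∈ p.baseVerts, HasEntranceVert S v

/-- Condition (Cyc): every `G`-cycle has an entrance. -/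
def CondCyc (S : SSA) : Prop := ∀ (g : S.G) (p : Path S), GCycle S g p → p.hasEntrance

/-- `g` has slack. -/
def HasSlack (S : SSA) (g : S.G) : Prop :=
  ∃ F : Finset (Path S), (∀ p ∈ F, SFix S g p) ∧
    ∀ q : Path S, q.rng = S.gs g → ∃ p ∈ F, Comparable S p q

/-- Condition (Sla): if `g` fixes every path in `s(g)E^*` then `g` has slack. -/
def CondSla (S : SSA) : Prop := ∀ g : S.G, FixesAll S g → HasSlack S g

def InfPath.rng (ξ : InfPath S) : S.V := S.er (ξ.seq 0)

/-- Base vertices of an infinite path. -/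
def InfPath.baseVerts (ξ : InfPath S) : Set S.V := {v : S.V | ∃ n, S.er (ξ.seq n) = v}

/-- An infinite path has an entrance. -/
def InfPath.hasEntrance (ξ : InfPath S) : Prop := ∃ v ∈ ξ.baseVerts, HasEntranceVert S v

/-- The finite path `p` is a prefix of the infinite path `ξ`. -/
def PrefixOfInf (S : SSA) (p : Path S) (ξ : InfPath S) : Prop :=
  p.rng = ξ.rng ∧ ∀ i : ℕ, i < p.length → p.toList[i]? = some (ξ.seq i)

/-- Finite or infinite paths. -/
abbrev GenPath (S : SSA) : Type := Path S ⊕ InfPath S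

/-- The finite path `p` is a prefix of the finite or infinite path `ξ`. -/
def GPrefix (S : SSA) (p : Path S) : GenPath S → Prop
  | .inl q => IsPrefix S p q
  | .inr ξ => PrefixOfInf S p ξ

/-- The set `vE¹` of edges received by the vertex `v`. -/
def recvSet (S : SSA) (v : S.V) : Set S.E := {e : S.E | S.er e = v}

/-- A vertex is singular if it is a source or an infinite receiver. -/
def Singular (S : SSA) (v : S.V) : Prop := recvSet S v = ∅ ∨ (recvSet S v).Infinite

/-- A vertex is regular if it is not singular. -/
def Regular (S : SSA) (v : S.V) : Prop := ¬ Singular S v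

/-- The preorder `v ≪ w`: there is `v'` with `vE^*v' ≠ ∅` and `v'Gw ≠ ∅`. -/
def ll (S : SSA) (v w : S.V) : Prop :=
  ∃ (p : Path S) (g : S.G), p.rng = v ∧ S.gr g = p.src ∧ S.gs g = w

/-- Cofinality of the self-similar action: for every boundary path (a finite path
with singular source, or an infinite path) and every vertex `v`, some base vertex
`w` of the path satisfies `v ≪ w`. -/
def Cofinal (S : SSA) : Prop :=
  (∀ p : Path S, Singular S p.src → ∀ v : S.V, ∃ w ∈ p.baseVerts, ll S v w) ∧
  (∀ ξ : InfPath S, ∀ v : S.V, ∃ w ∈ ξ.baseVerts, ll S v w)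

def Hereditary (S : SSA) (W : Set S.V) : Prop :=
  ∀ v ∈ W, ∀ p : Path S, p.rng = v → p.src ∈ W

def Saturated (S : SSA) (W : Set S.V) : Prop :=
  ∀ w : S.V, Regular S w → (∀ e : S.E, S.er e = w → S.es e ∈ W) → w ∈ W

def GInvariant (S : SSA) (W : Set S.V) : Prop := ∀ g : S.G, S.gs g ∈ W → S.gr g ∈ W

/-- `(G,E)`-invariant subsets of `E⁰`: `G`-invariant, hereditary and saturated. -/
def SSAInvariant (S : SSA) (W : Set S.V) : Prop :=
  GInvariant S W ∧ Hereditary S W ∧ Saturated S W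

/-- Condition (Con): every vertex is reachable from a `G`-cycle with an entrance. -/
def CondCon (S : SSA) : Prop :=
  ∀ v : S.V, ∃ p : Path S, p.rng = v ∧
    ∃ (g : S.G) (c : Path S), GCycle S g c ∧ c.hasEntrance ∧ p.src ∈ c.baseVerts

/-- The underlying set (with zero `none`) of the inverse semigroup `S(G,E)`. -/
abbrev SGE (S : SSA) : Type := Option (Path S × S.G × Path S)

/-- Well-formedness of a triple `(α, g, β)` : `r g = s α` and `s g = s β`. -/
def SGE.wf (S : SSA) : SGE S → Prop
  | none => True
  | some (α, g, β) => S.gr g = α.src ∧ S.gs g = β.src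

/-- The idempotent `f_α = (α, s α, α)`. -/
def fIdem (S : SSA) (α : Path S) : SGE S := some (α, S.one α.src, α)

/-- The involution `(α,g,β)* = (β,g⁻¹,α)` on `S(G,E)`. -/
def sgeStar (S : SSA) : SGE S → SGE S
  | none => none
  | some (α, g, β) => some (β, S.inv g, α)

/-- The multiplication of the inverse semigroup `S(G,E)`. -/
def sgeMul (S : SSA) : SGE S → SGE S → SGE S
  | none, _ => none
  | some _, none => none
  | some (α, g, β), some (γ, h, δ) =>
    if SGE.wf S (some (α, g, β)) ∧ SGE.wf S (some (γ, h, δ)) then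
      if h1 : ∃ β' : Path S, β.src = Path.rng β' ∧ γ = β.comp β' then
        some (α.comp (pact S g h1.choose), S.mul (pres S g h1.choose) h, δ)
      else if h2 : ∃ γ' : Path S, γ.src = Path.rng γ' ∧ β = γ.comp γ' then
        some (α, S.mul g (S.inv (pres S (S.inv h) h2.choose)),
          δ.comp (pact S (S.inv h) h2.choose))
      else none
    else none

/-- Membership in the subsemigroup `S₀(G,E)` (with zero): triples with `|α| = |β|`. -/
def domS0 (S : SSA) (x : SGE S) : Prop :=
  SGE.wf S x ∧ (x = none ∨ ∃ (α : Path S) (g : S.G) (β : Path S),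
    x = some (α, g, β) ∧ α.length = β.length)

/-- Membership in the subsemigroup `S₀₀(G,E)` (with zero): triples `(g·β, g|_β, β)`. -/
def domS00 (S : SSA) (x : SGE S) : Prop :=
  SGE.wf S x ∧ (x = none ∨ ∃ (g : S.G) (β : Path S),
    S.gs g = β.rng ∧ x = some (pact S g β, pres S g β, β))

/-- `S(G,E)` as raw inverse-semigroup data. -/
def sgeSem (S : SSA) : RawSem (SGE S) := ⟨sgeMul S, sgeStar S, none, SGE.wf S⟩

/-- `S₀(G,E)` as raw inverse-semigroup data. -/
def sgeSem0 (S : SSA) : RawSem (SGE S) := ⟨sgeMul S, sgeStar S, none, domS0 S⟩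

/-- `S₀₀(G,E)` as raw inverse-semigroup data. -/
def sgeSem00 (S : SSA) : RawSem (SGE S) := ⟨sgeMul S, sgeStar S, none, domS00 S⟩

/-- The inductive extension of `σ_⋈` to finite paths:
`σ_⋈(h, s h) = 1`, `σ_⋈(h, e μ) = σ_⋈(h, e) σ_⋈(h|_e, μ)`. -/
def twAux (S : SSA) (σB : S.G → S.E → ℂ) : ∀ {a b : S.V}, S.G → S.Pth a b → ℂ
  | _, _, _, .nil _ => 1
  | _, _, g, .cons e p => σB g e * twAux S σB (S.res g e) p

/-- The extension `σ_⋈ : G * E^* → 𝕋` of a twist to finite paths. -/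
def twP (S : SSA) (σB : S.G → S.E → ℂ) (g : S.G) (p : Path S) : ℂ := twAux S σB g p.pth

/-- The `2`-cocycle `ω_σ` on `S(G,E)` induced by a twist `σ` of `(G,E)`. -/
def omg (S : SSA) (T : Twist S) : SGE S → SGE S → ℂ := fun x y =>
  match x, y with
  | some (_, g, β), some (γ, h, _) =>
    if h1 : ∃ β' : Path S, β.src = Path.rng β' ∧ γ = β.comp β' then
      twP S T.σB g h1.choose * T.σG (pres S g h1.choose) h
    else if h2 : ∃ γ' : Path S, γ.src = Path.rng γ' ∧ β = γ.comp γ' then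
      T.σG g (S.inv (pres S (S.inv h) h2.choose)) * twP S T.σB h (pact S (S.inv h) h2.choose)
    else 1
  | _, _ => 1

end SSA

namespace SSA

theorem comp_ofEdge (S : SSA) (f : S.E) (q : Path S) (h : S.es f = q.rng) :
    ∃ (b : S.V) (p : S.Pth (S.es f) b), q = ⟨S.es f, b, p⟩ ∧
      (Path.ofEdge S f).comp q = ⟨S.er f, b, .cons f p⟩ := by
  obtain ⟨a, b, q⟩ := q
  dsimp only at h
  subst h
  refine ⟨b, q, rfl, ?_⟩
  simp [Path.comp, Path.ofEdge]
  rfl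

theorem twP_ofEdge_comp (S : SSA) (σB : S.G → S.E → ℂ) (g : S.G) (f : S.E) (q : Path S)
    (h : S.es f = q.rng) :
    twP S σB g ((Path.ofEdge S f).comp q) = σB g f * twP S σB (S.res g f) q := by
  obtain ⟨b, p, h1, h2⟩ := comp_ofEdge S f q h
  rw [h2, h1]
  rfl

theorem pres_ofEdge_comp (S : SSA) (g : S.G) (f : S.E) (q : Path S)
    (h : S.es f = q.rng) :
    pres S g ((Path.ofEdge S f).comp q) = pres S (S.res g f) q := by
  obtain ⟨b, p, h1, h2⟩ := comp_ofEdge S f q h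
  rw [h2, h1]
  rfl

theorem pactAux_rng (S : SSA) {a b : S.V} (p : S.Pth a b) :
    ∀ g : S.G, S.gs g = a → (pactAux S g p).rng = S.gr g := by
  induction p with
  | nil v => intro g _; rfl
  | cons e p ih =>
    intro g hg
    have h1 : S.es (S.act g e) = (pactAux S (S.res g e) p).rng := by
      rw [ih _ (S.gs_res g e hg), S.gr_res g e hg]
    obtain ⟨b, q, -, h2⟩ := comp_ofEdge S _ _ h1
    rw [pactAux, h2]
    exact S.er_act g e hg

theorem res_one (S : SSA) (e : S.E) : S.res (S.one (S.er e)) e = S.one (S.es e) := by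
  have hs := S.gs_res (S.one (S.er e)) e (S.gs_one _)
  have hr := S.gr_res (S.one (S.er e)) e (S.gs_one _)
  rw [S.act_one] at hr
  have h := S.res_mul (S.one (S.er e)) (S.one (S.er e)) e
    (by rw [S.gs_one, S.gr_one]) (S.gs_one _)
  have hm := S.one_mul' (S.one (S.er e))
  rw [S.gr_one] at hm
  rw [hm, S.act_one] at h
  generalize S.res (S.one (S.er e)) e = k at *
  have h3 := S.mul_assoc' (S.inv k) k k (S.gs_inv k) (hs.trans hr.symm)
  rw [← h, S.inv_mul'] at h3
  have h4 := S.one_mul' k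
  rw [hr, ← hs] at h4
  rw [← h4, h3, hs]

theorem twAux_norm (S : SSA) (T : Twist S) {a b : S.V} (p : S.Pth a b) :
    ∀ g : S.G, S.gs g = a → ‖twAux S T.σB g p‖ = 1 := by
  induction p with
  | nil v => intro g _; simp [twAux]
  | cons e p ih =>
    intro g hg
    rw [twAux, norm_mul, ih _ (S.gs_res g e hg), T.σB_unimod g e hg, one_mul]

theorem twAux_one (S : SSA) (T : Twist S) {a b : S.V} (p : S.Pth a b) :
    twAux S T.σB (S.one a) p = 1 := by
  induction p with
  | nil v => rfl
  | cons e p ih => rw [twAux, res_one, ih, T.σB_one, one_mul]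

theorem twAux_comp (S : SSA) (T : Twist S) {a b c : S.V} (p : S.Pth a b) (q : S.Pth b c) :
    ∀ g : S.G, twAux S T.σB g (p.comp q) =
      twAux S T.σB g p * twAux S T.σB (presAux S g p) q := by
  induction p with
  | nil v => intro g; simp [twAux, Pth.comp, presAux]
  | cons e p ih => intro g; rw [Pth.comp, twAux, ih, twAux, presAux, mul_assoc]

theorem twAux_unique (S : SSA) (T : Twist S) (σ' : S.G → Path S → ℂ)
    (h0 : ∀ h : S.G, σ' h (Path.vert S (S.gs h)) = 1)
    (h1 : ∀ (h : S.G) (e : S.E) (μ : Path S), S.gs h = S.er e → S.es e = μ.rng →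
        σ' h ((Path.ofEdge S e).comp μ) = T.σB h e * σ' (S.res h e) μ)
    {a b : S.V} (p : S.Pth a b) :
    ∀ g : S.G, S.gs g = a → σ' g ⟨a, b, p⟩ = twAux S T.σB g p := by
  induction p with
  | nil v => intro g hg; subst hg; exact h0 g
  | @cons e b p ih =>
    intro g hg
    have h := h1 g e ⟨_, _, p⟩ hg rfl
    rw [ih _ (S.gs_res g e hg)] at h
    rw [twAux, ← h]
    simp [Path.comp, Path.ofEdge]
    rfl

theorem twAux_cocycle (S : SSA) (T : Twist S) {a b : S.V} (p : S.Pth a b) :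
    ∀ g h : S.G, S.gs g = S.gr h → S.gs h = a →
      twAux S T.σB h p * (starRingEnd ℂ) (twAux S T.σB (S.mul g h) p) *
          twP S T.σB g (pactAux S h p) =
        (starRingEnd ℂ) (T.σG (pres S g (pactAux S h p)) (presAux S h p)) * T.σG g h := by
  induction p with
  | nil v =>
    intro g h hg _
    have := T.σG_unimod g h hg
    simp only [twAux, twP, pactAux, Path.vert, pres, presAux]
    rw [← Complex.normSq_eq_conj_mul_self, Complex.normSq_eq_norm_sq, this]
    simp
  | cons e p ih =>
    intro g h hg hh
    have hg' : S.gs g = S.er (S.act h e) := by rw [S.er_act h e hh, hg]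
    have hc : S.gs (S.res g (S.act h e)) = S.gr (S.res h e) := by
      rw [S.gs_res _ _ hg', S.gr_res _ _ hh]
    have h1 : S.es (S.act h e) = (pactAux S (S.res h e) p).rng := by
      rw [pactAux_rng S p _ (S.gs_res h e hh), S.gr_res h e hh]
    have i1 := ih _ _ hc (S.gs_res h e hh)
    have i2 := T.σB_cocycle g h e hg hh
    have i3 : (starRingEnd ℂ) (T.σG (S.res g (S.act h e)) (S.res h e)) *
        T.σG (S.res g (S.act h e)) (S.res h e) = 1 := by
      rw [← Complex.normSq_eq_conj_mul_self, Complex.normSq_eq_norm_sq, T.σG_unimod _ _ hc]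
      simp
    rw [pactAux, twP_ofEdge_comp S _ _ _ _ h1, pres_ofEdge_comp S _ _ _ h1, twAux, twAux, presAux,
      S.res_mul g h e hg hh, map_mul]
    linear_combination (T.σB h e * (starRingEnd ℂ) (T.σB (S.mul g h) e) * T.σB g (S.act h e)) * i1
      + (starRingEnd ℂ) (T.σG (pres S (S.res g (S.act h e)) (pactAux S (S.res h e) p))
          (presAux S (S.res h e) p)) * T.σG (S.res g (S.act h e)) (S.res h e) * i2
      + (starRingEnd ℂ) (T.σG (pres S (S.res g (S.act h e)) (pactAux S (S.res h e) p))
          (presAux S (S.res h e) p)) * T.σG g h * i3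

end SSA

/-- The map `σ_⋈` of a twist extends to `G * E^* → 𝕋`, determined
inductively by `σ_⋈(h, e μ) = σ_⋈(h,e) σ_⋈(h|_e, μ)` and `σ_⋈(h, s h) = 1` (the
extension is `SSA.twP`, and it is the unique map satisfying these rules on
composable inputs), and the extension is unimodular and satisfies:
(1) `σ_⋈(h, s h) = 1` and `σ_⋈(r μ, μ) = 1`;
(2) `σ_⋈(h, λμ) = σ_⋈(h, λ) σ_⋈(h|_λ, μ)`;
(3) `σ_⋈(h,λ) conj(σ_⋈(gh,λ)) σ_⋈(g, h·λ) = conj(σ_G(g|_{h·λ}, h|_λ)) σ_G(g,h)`. -/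
theorem statement15 (S : SSA) (T : SSA.Twist S) :
    (∀ (h : S.G) (μ : SSA.Path S), S.gs h = μ.rng → ‖SSA.twP S T.σB h μ‖ = 1) ∧
    (∀ h : S.G, SSA.twP S T.σB h (SSA.Path.vert S (S.gs h)) = 1) ∧
    (∀ (h : S.G) (e : S.E) (μ : SSA.Path S), S.gs h = S.er e → S.es e = μ.rng →
      SSA.twP S T.σB h ((SSA.Path.ofEdge S e).comp μ) =
        T.σB h e * SSA.twP S T.σB (S.res h e) μ) ∧
    (∀ σ' : S.G → SSA.Path S → ℂ,
      (∀ h : S.G, σ' h (SSA.Path.vert S (S.gs h)) = 1) →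
      (∀ (h : S.G) (e : S.E) (μ : SSA.Path S), S.gs h = S.er e → S.es e = μ.rng →
        σ' h ((SSA.Path.ofEdge S e).comp μ) = T.σB h e * σ' (S.res h e) μ) →
      ∀ (h : S.G) (μ : SSA.Path S), S.gs h = μ.rng → σ' h μ = SSA.twP S T.σB h μ) ∧
    (∀ μ : SSA.Path S, SSA.twP S T.σB (S.one μ.rng) μ = 1) ∧
    (∀ (h : S.G) (l μ : SSA.Path S), S.gs h = l.rng → l.src = μ.rng →
      SSA.twP S T.σB h (l.comp μ) =
        SSA.twP S T.σB h l * SSA.twP S T.σB (SSA.pres S h l) μ) ∧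
    (∀ (g h : S.G) (l : SSA.Path S), S.gs g = S.gr h → S.gs h = l.rng →
      SSA.twP S T.σB h l * (starRingEnd ℂ) (SSA.twP S T.σB (S.mul g h) l) *
          SSA.twP S T.σB g (SSA.pact S h l) =
        (starRingEnd ℂ) (T.σG (SSA.pres S g (SSA.pact S h l)) (SSA.pres S h l)) *
          T.σG g h) := by
  refine ⟨fun h μ hh => SSA.twAux_norm S T μ.pth h hh, fun h => rfl,
    fun h e μ _ h2 => SSA.twP_ofEdge_comp S _ h e μ h2,
    fun σ' h0 h1 h μ hh => SSA.twAux_unique S T σ' h0 h1 μ.pth h hh,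
    fun μ => SSA.twAux_one S T μ.pth, ?_,
    fun g h l h1 h2 => SSA.twAux_cocycle S T l.pth g h h1 h2⟩
  rintro h ⟨a, b, p⟩ ⟨c, d, q⟩ _ h2
  dsimp only at h2
  subst h2
  have h3 : SSA.Path.comp ⟨a, b, p⟩ ⟨b, d, q⟩ = ⟨a, d, p.comp q⟩ := by
    simp [SSA.Path.comp]
  rw [h3]
  exact SSA.twAux_comp S T p q h

end
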